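/- (Subject reduction) Let R be a polarized rewrite system such that the relations →₋ and →₊ commute. If π is a proof-term of Γ ⊢_R A in polarized natural deduction modulo R and π ▷ π', then π' is a proof-term of Γ ⊢_R A. -/

import Mathlib

/-- Propositional formulas: atoms (indexed by naturals), ⊥, ⇒, ∧, ∨. -/
inductive Form : Type where
  | atom : ℕ → Form
  | bot  : Form
  | imp  : Form → Form → Form
  | and  : Form → Form → Form
  | or   : Form → Form → Form

/-- A polarized rewrite system: a set of negative rules and a set of positive
rules, each rewriting an atomic proposition to an arbitrary formula. -/
structure PRS : Type where
  neg : ℕ → Form → Prop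
  pos : ℕ → Form → Prop

mutual
  /-- One step negative rewriting →₋¹. -/
  inductive Neg1 (R : PRS) : Form → Form → Prop where
    | rule {P A} : R.neg P A → Neg1 R (.atom P) A
    | impL {A A' B} : Pos1 R A A' → Neg1 R (.imp A B) (.imp A' B)
    | impR {A B B'} : Neg1 R B B' → Neg1 R (.imp A B) (.imp A B')
    | andL {A A' B} : Neg1 R A A' → Neg1 R (.and A B) (.and A' B)
    | andR {A B B'} : Neg1 R B B' → Neg1 R (.and A B) (.and A B')
    | orL  {A A' B} : Neg1 R A A' → Neg1 R (.or A B) (.or A' B)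
    | orR  {A B B'} : Neg1 R B B' → Neg1 R (.or A B) (.or A B')
  /-- One step positive rewriting →₊¹. -/
  inductive Pos1 (R : PRS) : Form → Form → Prop where
    | rule {P A} : R.pos P A → Pos1 R (.atom P) A
    | impL {A A' B} : Neg1 R A A' → Pos1 R (.imp A B) (.imp A' B)
    | impR {A B B'} : Pos1 R B B' → Pos1 R (.imp A B) (.imp A B')
    | andL {A A' B} : Pos1 R A A' → Pos1 R (.and A B) (.and A' B)
    | andR {A B B'} : Pos1 R B B' → Pos1 R (.and A B) (.and A B')
    | orL  {A A' B} : Pos1 R A A' → Pos1 R (.or A B) (.or A' B)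
    | orR  {A B B'} : Pos1 R B B' → Pos1 R (.or A B) (.or A B')
end

/-- →₋ : reflexive-transitive closure of →₋¹. -/
def NegR (R : PRS) : Form → Form → Prop := Relation.ReflTransGen (Neg1 R)

/-- →₊ : reflexive-transitive closure of →₊¹. -/
def PosR (R : PRS) : Form → Form → Prop := Relation.ReflTransGen (Pos1 R)

/-- The relations →₋ and →₊ commute. -/
def Commutes (R : PRS) : Prop :=
  ∀ A B C, NegR R B A → PosR R B C → ∃ D, PosR R A D ∧ NegR R C D

/-- Proof-terms (de Bruijn representation of the proof variables). -/
inductive PTerm : Type where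
  | var  : ℕ → PTerm
  | lam  : PTerm → PTerm
  | app  : PTerm → PTerm → PTerm
  | pair : PTerm → PTerm → PTerm
  | fst  : PTerm → PTerm
  | snd  : PTerm → PTerm
  | inl  : PTerm → PTerm
  | inr  : PTerm → PTerm
  | case : PTerm → PTerm → PTerm → PTerm
  | exf  : PTerm → PTerm

/-- Shift by one all de Bruijn indices ≥ c. -/
def liftAbove (c : ℕ) : PTerm → PTerm
  | .var n => if n < c then .var n else .var (n+1)
  | .lam π => .lam (liftAbove (c+1) π)
  | .app a b => .app (liftAbove c a) (liftAbove c b)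
  | .pair a b => .pair (liftAbove c a) (liftAbove c b)
  | .fst a => .fst (liftAbove c a)
  | .snd a => .snd (liftAbove c a)
  | .inl a => .inl (liftAbove c a)
  | .inr a => .inr (liftAbove c a)
  | .case a b c' => .case (liftAbove c a) (liftAbove (c+1) b) (liftAbove (c+1) c')
  | .exf a => .exf (liftAbove c a)

/-- Substitution [u/k]π of the term u for the variable k. -/
def subst (k : ℕ) (u : PTerm) : PTerm → PTerm
  | .var n => if n < k then .var n else if n = k then u else .var (n-1)
  | .lam π => .lam (subst (k+1) (liftAbove 0 u) π)
  | .app a b => .app (subst k u a) (subst k u b)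
  | .pair a b => .pair (subst k u a) (subst k u b)
  | .fst a => .fst (subst k u a)
  | .snd a => .snd (subst k u a)
  | .inl a => .inl (subst k u a)
  | .inr a => .inr (subst k u a)
  | .case a b c => .case (subst k u a) (subst (k+1) (liftAbove 0 u) b) (subst (k+1) (liftAbove 0 u) c)
  | .exf a => .exf (subst k u a)

/-- Typing judgement of polarized natural deduction modulo R:
`Typed R Γ π A` means "π is a proof-term of Γ ⊢_R A".
A context is a finite list of formulas (the declaration of variable n is the
n-th entry of the list). -/
inductive Typed (R : PRS) : List Form → PTerm → Form → Prop where
  | ax {Γ n A B C} : Γ[n]? = some A → NegR R A C → PosR R B C →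
      Typed R Γ (.var n) B
  | impI {Γ π A B C} : Typed R (A :: Γ) π B → PosR R C (.imp A B) →
      Typed R Γ (.lam π) C
  | impE {Γ π₁ π₂ A B C} : Typed R Γ π₁ C → NegR R C (.imp A B) →
      Typed R Γ π₂ A → Typed R Γ (.app π₁ π₂) B
  | andI {Γ π₁ π₂ A B C} : Typed R Γ π₁ A → Typed R Γ π₂ B →
      PosR R C (.and A B) → Typed R Γ (.pair π₁ π₂) C
  | andE₁ {Γ π A B C} : Typed R Γ π C → NegR R C (.and A B) →
      Typed R Γ (.fst π) A
  | andE₂ {Γ π A B C} : Typed R Γ π C → NegR R C (.and A B) →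
      Typed R Γ (.snd π) B
  | orI₁ {Γ π A B C} : Typed R Γ π A → PosR R C (.or A B) →
      Typed R Γ (.inl π) C
  | orI₂ {Γ π A B C} : Typed R Γ π B → PosR R C (.or A B) →
      Typed R Γ (.inr π) C
  | orE {Γ π₁ π₂ π₃ A B C D} : Typed R Γ π₁ D → NegR R D (.or A B) →
      Typed R (A :: Γ) π₂ C → Typed R (B :: Γ) π₃ C →
      Typed R Γ (.case π₁ π₂ π₃) C
  | botE {Γ π A B} : Typed R Γ π B → NegR R B .bot →
      Typed R Γ (.exf π) A

/-- One step proof reduction ▷¹ (contextual closure of the cut elimination rules). -/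
inductive Red1 : PTerm → PTerm → Prop where
  | beta {π₁ π₂} : Red1 (.app (.lam π₁) π₂) (subst 0 π₂ π₁)
  | fstPair {π₁ π₂} : Red1 (.fst (.pair π₁ π₂)) π₁
  | sndPair {π₁ π₂} : Red1 (.snd (.pair π₁ π₂)) π₂
  | caseInl {π₁ π₂ π₃} : Red1 (.case (.inl π₁) π₂ π₃) (subst 0 π₁ π₂)
  | caseInr {π₁ π₂ π₃} : Red1 (.case (.inr π₁) π₂ π₃) (subst 0 π₁ π₃)
  | lam {π π'} : Red1 π π' → Red1 (.lam π) (.lam π')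
  | appL {π π' ρ} : Red1 π π' → Red1 (.app π ρ) (.app π' ρ)
  | appR {π ρ ρ'} : Red1 ρ ρ' → Red1 (.app π ρ) (.app π ρ')
  | pairL {π π' ρ} : Red1 π π' → Red1 (.pair π ρ) (.pair π' ρ)
  | pairR {π ρ ρ'} : Red1 ρ ρ' → Red1 (.pair π ρ) (.pair π ρ')
  | fst {π π'} : Red1 π π' → Red1 (.fst π) (.fst π')
  | snd {π π'} : Red1 π π' → Red1 (.snd π) (.snd π')
  | inl {π π'} : Red1 π π' → Red1 (.inl π) (.inl π')
  | inr {π π'} : Red1 π π' → Red1 (.inr π) (.inr π')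
  | case₁ {π π' ρ τ} : Red1 π π' → Red1 (.case π ρ τ) (.case π' ρ τ)
  | case₂ {π ρ ρ' τ} : Red1 ρ ρ' → Red1 (.case π ρ τ) (.case π ρ' τ)
  | case₃ {π ρ τ τ'} : Red1 τ τ' → Red1 (.case π ρ τ) (.case π ρ τ')
  | exf {π π'} : Red1 π π' → Red1 (.exf π) (.exf π')

/-- ▷ : reflexive-transitive closure of ▷¹. -/
def Red : PTerm → PTerm → Prop := Relation.ReflTransGen Red1

/-- A proof-term is strongly normalizable if every ▷¹-reduction sequence from
it is finite, i.e. it is accessible for the inverse of ▷¹. -/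
def SN (π : PTerm) : Prop := Acc (fun x y => Red1 y x) π

/-- Neutral proof-terms: variables and eliminations, not introductions. -/
def Neutral : PTerm → Prop
  | .var _ => True
  | .app _ _ => True
  | .fst _ => True
  | .snd _ => True
  | .case _ _ _ => True
  | .exf _ => True
  | _ => False

/-- Reducibility candidates. -/
structure IsCandidate (S : Set PTerm) : Prop where
  sn : ∀ π ∈ S, SN π
  closed : ∀ π ∈ S, ∀ π', Red π π' → π' ∈ S
  neutral : ∀ π, Neutral π → (∀ π', Red1 π π' → π' ∈ S) → π ∈ S

/-- A pre-model is an assignment of a reducibility candidate to each atom. -/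
def IsPreModel (M : ℕ → Set PTerm) : Prop := ∀ P, IsCandidate (M P)

/-- The interpretation |A| of a formula in a pre-model. -/
def interp (M : ℕ → Set PTerm) : Form → Set PTerm
  | .atom P => M P
  | .bot => {π | SN π}
  | .imp A B => {π | SN π ∧ ∀ π₁, Red π (.lam π₁) →
      ∀ π' ∈ interp M A, subst 0 π' π₁ ∈ interp M B}
  | .and A B => {π | SN π ∧ ∀ π₁ π₂, Red π (.pair π₁ π₂) →
      π₁ ∈ interp M A ∧ π₂ ∈ interp M B}
  | .or A B => {π | SN π ∧ (∀ π₁, Red π (.inl π₁) → π₁ ∈ interp M A) ∧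
      (∀ π₂, Red π (.inr π₂) → π₂ ∈ interp M B)}

/-- A pre-model of a polarized rewrite system R. -/
def IsPreModelOf (R : PRS) (M : ℕ → Set PTerm) : Prop :=
  IsPreModel M ∧
  (∀ P A, R.neg P A → interp M (.atom P) ⊆ interp M A) ∧
  (∀ P A, R.pos P A → interp M A ⊆ interp M (.atom P))

section

variable {R : PRS} {Γ : List Form} {A B C D X : Form} {π u : PTerm}

theorem NegR.imp_inv (h : NegR R (.imp A B) X) :
    ∃ A' B', X = .imp A' B' ∧ PosR R A A' ∧ NegR R B B' := by
  induction h with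
  | refl => exact ⟨A, B, rfl, .refl, .refl⟩
  | tail _ hs ih =>
    obtain ⟨A', B', rfl, hA, hB⟩ := ih
    cases hs with
    | impL hs => exact ⟨_, _, rfl, hA.tail hs, hB⟩
    | impR hs => exact ⟨_, _, rfl, hA, hB.tail hs⟩

theorem PosR.imp_inv (h : PosR R (.imp A B) X) :
    ∃ A' B', X = .imp A' B' ∧ NegR R A A' ∧ PosR R B B' := by
  induction h with
  | refl => exact ⟨A, B, rfl, .refl, .refl⟩
  | tail _ hs ih =>
    obtain ⟨A', B', rfl, hA, hB⟩ := ih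
    cases hs with
    | impL hs => exact ⟨_, _, rfl, hA.tail hs, hB⟩
    | impR hs => exact ⟨_, _, rfl, hA, hB.tail hs⟩

theorem NegR.and_inv (h : NegR R (.and A B) X) :
    ∃ A' B', X = .and A' B' ∧ NegR R A A' ∧ NegR R B B' := by
  induction h with
  | refl => exact ⟨A, B, rfl, .refl, .refl⟩
  | tail _ hs ih =>
    obtain ⟨A', B', rfl, hA, hB⟩ := ih
    cases hs with
    | andL hs => exact ⟨_, _, rfl, hA.tail hs, hB⟩
    | andR hs => exact ⟨_, _, rfl, hA, hB.tail hs⟩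

theorem PosR.and_inv (h : PosR R (.and A B) X) :
    ∃ A' B', X = .and A' B' ∧ PosR R A A' ∧ PosR R B B' := by
  induction h with
  | refl => exact ⟨A, B, rfl, .refl, .refl⟩
  | tail _ hs ih =>
    obtain ⟨A', B', rfl, hA, hB⟩ := ih
    cases hs with
    | andL hs => exact ⟨_, _, rfl, hA.tail hs, hB⟩
    | andR hs => exact ⟨_, _, rfl, hA, hB.tail hs⟩

theorem NegR.or_inv (h : NegR R (.or A B) X) :
    ∃ A' B', X = .or A' B' ∧ NegR R A A' ∧ NegR R B B' := by
  induction h with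
  | refl => exact ⟨A, B, rfl, .refl, .refl⟩
  | tail _ hs ih =>
    obtain ⟨A', B', rfl, hA, hB⟩ := ih
    cases hs with
    | orL hs => exact ⟨_, _, rfl, hA.tail hs, hB⟩
    | orR hs => exact ⟨_, _, rfl, hA, hB.tail hs⟩

theorem PosR.or_inv (h : PosR R (.or A B) X) :
    ∃ A' B', X = .or A' B' ∧ PosR R A A' ∧ PosR R B B' := by
  induction h with
  | refl => exact ⟨A, B, rfl, .refl, .refl⟩
  | tail _ hs ih =>
    obtain ⟨A', B', rfl, hA, hB⟩ := ih
    cases hs with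
    | orL hs => exact ⟨_, _, rfl, hA.tail hs, hB⟩
    | orR hs => exact ⟨_, _, rfl, hA, hB.tail hs⟩

theorem PosR.imp_right (A : Form) (h : PosR R B C) : PosR R (.imp A B) (.imp A C) :=
  Relation.ReflTransGen.lift (Form.imp A) (fun _ _ hs => Pos1.impR hs) _ _ h

theorem NegR.imp_right (A : Form) (h : NegR R B C) : NegR R (.imp A B) (.imp A C) :=
  Relation.ReflTransGen.lift (Form.imp A) (fun _ _ hs => Neg1.impR hs) _ _ h

theorem PosR.and_left (B : Form) (h : PosR R A C) : PosR R (.and A B) (.and C B) :=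
  Relation.ReflTransGen.lift (Form.and · B) (fun _ _ hs => Pos1.andL hs) _ _ h

theorem NegR.and_left (B : Form) (h : NegR R A C) : NegR R (.and A B) (.and C B) :=
  Relation.ReflTransGen.lift (Form.and · B) (fun _ _ hs => Neg1.andL hs) _ _ h

theorem PosR.and_right (A : Form) (h : PosR R B C) : PosR R (.and A B) (.and A C) :=
  Relation.ReflTransGen.lift (Form.and A) (fun _ _ hs => Pos1.andR hs) _ _ h

theorem NegR.and_right (A : Form) (h : NegR R B C) : NegR R (.and A B) (.and A C) :=
  Relation.ReflTransGen.lift (Form.and A) (fun _ _ hs => Neg1.andR hs) _ _ h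

/-- Positively rewriting hypotheses preserves typing. -/
theorem Typed.context_posR (hc : Commutes R) {Δ : List Form} (h : Typed R Γ π A)
    (hΔ : List.Forall₂ (PosR R) Γ Δ) : Typed R Δ π A := by
  induction h generalizing Δ with
  | @ax Γ n A B C hn hA hB =>
    obtain ⟨hlt, rfl⟩ := List.getElem?_eq_some_iff.1 hn
    have hlt' : n < Δ.length := hΔ.length_eq ▸ hlt
    obtain ⟨D, hCD, hD⟩ := hc _ _ _ hA (hΔ.get hlt hlt')
    exact .ax (List.getElem?_eq_getElem hlt') hD (hB.trans hCD)
  | impI _ h ih => exact .impI (ih (.cons .refl hΔ)) h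
  | impE _ h _ ih₁ ih₂ => exact .impE (ih₁ hΔ) h (ih₂ hΔ)
  | andI _ _ h ih₁ ih₂ => exact .andI (ih₁ hΔ) (ih₂ hΔ) h
  | andE₁ _ h ih => exact .andE₁ (ih hΔ) h
  | andE₂ _ h ih => exact .andE₂ (ih hΔ) h
  | orI₁ _ h ih => exact .orI₁ (ih hΔ) h
  | orI₂ _ h ih => exact .orI₂ (ih hΔ) h
  | orE _ h _ _ ih₁ ih₂ ih₃ =>
    exact .orE (ih₁ hΔ) h (ih₂ (.cons .refl hΔ)) (ih₃ (.cons .refl hΔ))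
  | botE _ h ih => exact .botE (ih hΔ) h

/-- A proof of `A` proves every negative reduct of `A`. -/
theorem Typed.negR (hc : Commutes R) (h : Typed R Γ π A) (hA : NegR R A B) :
    Typed R Γ π B := by
  induction h generalizing B with
  | ax hn hA' hB =>
    obtain ⟨D, hBD, hD⟩ := hc _ _ _ hA hB
    exact .ax hn (hA'.trans hD) hBD
  | @impI Γ π _ _ _ _ hC ih =>
    obtain ⟨D, hBD, hD⟩ := hc _ _ _ hA hC
    obtain ⟨A', B', rfl, h₁, h₂⟩ := hD.imp_inv
    exact .impI ((ih h₂).context_posR hc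
      (.cons h₁ (List.forall₂_same.2 fun _ _ => .refl))) hBD
  | impE h₁ hC h₂ => exact .impE h₁ (hC.trans (hA.imp_right _)) h₂
  | andI _ _ hC ih₁ ih₂ =>
    obtain ⟨D, hBD, hD⟩ := hc _ _ _ hA hC
    obtain ⟨A', B', rfl, h₁, h₂⟩ := hD.and_inv
    exact .andI (ih₁ h₁) (ih₂ h₂) hBD
  | andE₁ h hC => exact .andE₁ h (hC.trans (hA.and_left _))
  | andE₂ h hC => exact .andE₂ h (hC.trans (hA.and_right _))
  | orI₁ _ hC ih =>
    obtain ⟨D, hBD, hD⟩ := hc _ _ _ hA hC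
    obtain ⟨A', B', rfl, h₁, h₂⟩ := hD.or_inv
    exact .orI₁ (ih h₁) hBD
  | orI₂ _ hC ih =>
    obtain ⟨D, hBD, hD⟩ := hc _ _ _ hA hC
    obtain ⟨A', B', rfl, h₁, h₂⟩ := hD.or_inv
    exact .orI₂ (ih h₂) hBD
  | orE h₁ hD _ _ _ ih₂ ih₃ => exact .orE h₁ hD (ih₂ hA) (ih₃ hA)
  | botE h hB => exact .botE h hB

/-- A proof of a positive reduct of `B` proves `B`. -/
theorem Typed.posR (hc : Commutes R) (h : Typed R Γ π A) (hB : PosR R B A) :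
    Typed R Γ π B := by
  induction π generalizing Γ A B with
  | var => cases h with | ax hn hA hC => exact .ax hn hA (hB.trans hC)
  | lam => cases h with | impI h hC => exact .impI h (hB.trans hC)
  | app _ _ ih => cases h with
    | impE h₁ hC h₂ => exact .impE (ih (h₁.negR hc hC) (hB.imp_right _)) .refl h₂
  | pair => cases h with | andI h₁ h₂ hC => exact .andI h₁ h₂ (hB.trans hC)
  | fst _ ih => cases h with
    | andE₁ h hC => exact .andE₁ (ih (h.negR hc hC) (hB.and_left _)) .refl
  | snd _ ih => cases h with
    | andE₂ h hC => exact .andE₂ (ih (h.negR hc hC) (hB.and_right _)) .refl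
  | inl => cases h with | orI₁ h hC => exact .orI₁ h (hB.trans hC)
  | inr => cases h with | orI₂ h hC => exact .orI₂ h (hB.trans hC)
  | case _ _ _ _ ih₂ ih₃ => cases h with
    | orE h₁ hD h₂ h₃ => exact .orE h₁ hD (ih₂ h₂ hB) (ih₃ h₃ hB)
  | exf => cases h with | botE h hC => exact .botE h hC

/-- Weakening. -/
theorem Typed.liftAbove {Δ : List Form} (D : Form) (h : Typed R (Δ ++ Γ) π A) :
    Typed R (Δ ++ D :: Γ) (liftAbove Δ.length π) A := by
  generalize hE : Δ ++ Γ = E at h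
  induction h generalizing Δ with
  | @ax _ n _ _ _ hn hA hB =>
    subst hE
    rw [_root_.liftAbove]
    split
    · refine .ax ?_ hA hB
      grind
    · refine .ax ?_ hA hB
      grind
  | @impI _ _ A _ _ _ h ih => exact .impI (ih (Δ := A :: Δ) (by simp [hE])) h
  | impE _ h _ ih₁ ih₂ => exact .impE (ih₁ hE) h (ih₂ hE)
  | andI _ _ h ih₁ ih₂ => exact .andI (ih₁ hE) (ih₂ hE) h
  | andE₁ _ h ih => exact .andE₁ (ih hE) h
  | andE₂ _ h ih => exact .andE₂ (ih hE) h
  | orI₁ _ h ih => exact .orI₁ (ih hE) h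
  | orI₂ _ h ih => exact .orI₂ (ih hE) h
  | @orE _ _ _ _ A B _ _ _ h _ _ ih₁ ih₂ ih₃ =>
    exact .orE (ih₁ hE) h (ih₂ (Δ := A :: Δ) (by simp [hE]))
      (ih₃ (Δ := B :: Δ) (by simp [hE]))
  | botE _ h ih => exact .botE (ih hE) h

/-- Substitution lemma. -/
theorem Typed.subst (hc : Commutes R) {Δ : List Form} (h : Typed R (Δ ++ D :: Γ) π A)
    (hu : Typed R (Δ ++ Γ) u D) : Typed R (Δ ++ Γ) (subst Δ.length u π) A := by
  generalize hE : Δ ++ D :: Γ = E at h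
  induction h generalizing Δ u with
  | @ax _ n A _ _ hn hA hB =>
    cases hE
    rw [_root_.subst]
    split
    · refine .ax ?_ hA hB
      grind
    · split
      · obtain rfl : D = A := by simpa [*] using hn
        exact (hu.negR hc hA).posR hc hB
      · refine .ax ?_ hA hB
        grind
  | @impI _ _ A _ _ _ h ih =>
    exact .impI (ih (Δ := A :: Δ) (hu.liftAbove (Δ := []) A) (by simp [hE])) h
  | impE _ h _ ih₁ ih₂ => exact .impE (ih₁ hu hE) h (ih₂ hu hE)
  | andI _ _ h ih₁ ih₂ => exact .andI (ih₁ hu hE) (ih₂ hu hE) h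
  | andE₁ _ h ih => exact .andE₁ (ih hu hE) h
  | andE₂ _ h ih => exact .andE₂ (ih hu hE) h
  | orI₁ _ h ih => exact .orI₁ (ih hu hE) h
  | orI₂ _ h ih => exact .orI₂ (ih hu hE) h
  | @orE _ _ _ _ A B _ _ _ h _ _ ih₁ ih₂ ih₃ =>
    exact .orE (ih₁ hu hE) h
      (ih₂ (Δ := A :: Δ) (hu.liftAbove (Δ := []) A) (by simp [hE]))
      (ih₃ (Δ := B :: Δ) (hu.liftAbove (Δ := []) B) (by simp [hE]))
  | botE _ h ih => exact .botE (ih hu hE) h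

theorem Typed.red1 (hc : Commutes R) {π' : PTerm} (h : Typed R Γ π A)
    (hr : Red1 π π') : Typed R Γ π' A := by
  induction hr generalizing Γ A with
  | beta =>
    cases h with | impE h₁ hC h₂ =>
    cases h₁.negR hc hC with | impI h hP =>
    obtain ⟨_, _, hX, hA, hB⟩ := hP.imp_inv
    cases hX
    exact (h.subst hc (Δ := []) (h₂.negR hc hA)).posR hc hB
  | fstPair =>
    cases h with | andE₁ h hC =>
    cases h.negR hc hC with | andI h₁ h₂ hP =>
    obtain ⟨_, _, hX, hA, hB⟩ := hP.and_inv
    cases hX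
    exact h₁.posR hc hA
  | sndPair =>
    cases h with | andE₂ h hC =>
    cases h.negR hc hC with | andI h₁ h₂ hP =>
    obtain ⟨_, _, hX, hA, hB⟩ := hP.and_inv
    cases hX
    exact h₂.posR hc hB
  | caseInl =>
    cases h with | orE h hC h₂ h₃ =>
    cases h.negR hc hC with | orI₁ h₁ hP =>
    obtain ⟨_, _, hX, hA, hB⟩ := hP.or_inv
    cases hX
    exact h₂.subst hc (Δ := []) (h₁.posR hc hA)
  | caseInr =>
    cases h with | orE h hC h₂ h₃ =>
    cases h.negR hc hC with | orI₂ h₁ hP =>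
    obtain ⟨_, _, hX, hA, hB⟩ := hP.or_inv
    cases hX
    exact h₃.subst hc (Δ := []) (h₁.posR hc hB)
  | lam _ ih => cases h with | impI h hC => exact .impI (ih h) hC
  | appL _ ih => cases h with | impE h₁ hC h₂ => exact .impE (ih h₁) hC h₂
  | appR _ ih => cases h with | impE h₁ hC h₂ => exact .impE h₁ hC (ih h₂)
  | pairL _ ih => cases h with | andI h₁ h₂ hC => exact .andI (ih h₁) h₂ hC
  | pairR _ ih => cases h with | andI h₁ h₂ hC => exact .andI h₁ (ih h₂) hC
  | fst _ ih => cases h with | andE₁ h hC => exact .andE₁ (ih h) hC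
  | snd _ ih => cases h with | andE₂ h hC => exact .andE₂ (ih h) hC
  | inl _ ih => cases h with | orI₁ h hC => exact .orI₁ (ih h) hC
  | inr _ ih => cases h with | orI₂ h hC => exact .orI₂ (ih h) hC
  | case₁ _ ih => cases h with | orE h₁ hC h₂ h₃ => exact .orE (ih h₁) hC h₂ h₃
  | case₂ _ ih => cases h with | orE h₁ hC h₂ h₃ => exact .orE h₁ hC (ih h₂) h₃
  | case₃ _ ih => cases h with | orE h₁ hC h₂ h₃ => exact .orE h₁ hC h₂ (ih h₃)
  | exf _ ih => cases h with | botE h hC => exact .botE (ih h) hC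

end

/-- Subject reduction: if →₋ and →₊ commute, π is a proof-term of Γ ⊢_R A
and π ▷ π', then π' is a proof-term of Γ ⊢_R A. -/
theorem subject_reduction (R : PRS) (hcomm : Commutes R)
    (Γ : List Form) (π π' : PTerm) (A : Form)
    (h : Typed R Γ π A) (hred : Red π π') :
    Typed R Γ π' A := by
  induction hred with
  | refl => exact h
  | tail _ hs ih => exact ih.red1 hcomm hs
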